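/- Let σ > 0, let y_1, …, y_n ∈ ℝ^d, let U = (1/n) Σ_{i=1}^n δ_{y_i}, and let 𝒫 be a class of probability measures on ℝ^d with finite second moments that is closed under domination. For P ∈ 𝒫 define V(P) := inf over probability measures γ on ℝ^d × ℝ^d with second marginal U of [ (1/2) ∫ ‖x − y‖² dγ(x, y) + σ² I(γ) + σ² D(π_X γ ‖ P) ]. Then inf_{P ∈ 𝒫} V(P) = inf_{P ∈ 𝒫} W_{σ²}(P, U), and P̂ ∈ 𝒫 minimizes V over 𝒫 if and only if P̂ minimizes P ↦ W_{σ²}(P, U) over 𝒫. -/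

import Mathlib

open MeasureTheory ProbabilityTheory Real
open scoped ENNReal

noncomputable section
open Classical in

/-- The Kullback–Leibler divergence `D(μ ‖ ν)`, valued in `ℝ≥0∞`.
It equals `∫ log (dμ/dν) dμ` when `μ ≪ ν` and this integral is defined,
and `∞` otherwise.  (For probability measures the integral, when defined,
is nonnegative, so no truncation occurs.) -/
def KLdiv {α : Type*} [MeasurableSpace α] (μ ν : Measure α) : ℝ≥0∞ :=
  if μ ≪ ν ∧ Integrable (fun x => Real.log (μ.rnDeriv ν x).toReal) μ then
    ENNReal.ofReal (∫ x, Real.log (μ.rnDeriv ν x).toReal ∂μ)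
  else ⊤

/-- The mutual information `I(γ) = D(γ ‖ π_X γ ⊗ π_Y γ)` of a measure on a product space. -/
def mutualInfo {α β : Type*} [MeasurableSpace α] [MeasurableSpace β]
    (γ : Measure (α × β)) : ℝ≥0∞ :=
  KLdiv γ ((γ.map Prod.fst).prod (γ.map Prod.snd))

/-- The set of couplings of `μ` and `ν` : probability measures on the product with
first marginal `μ` and second marginal `ν`. -/
def couplings {α : Type*} [MeasurableSpace α] (μ ν : Measure α) :
    Set (Measure (α × α)) :=
  {γ | IsProbabilityMeasure γ ∧ γ.map Prod.fst = μ ∧ γ.map Prod.snd = ν}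

/-- The entropic optimal transport distance `W_{σ²}(μ, ν)`. -/
def entropicOT {E : Type*} [NormedAddCommGroup E] [MeasurableSpace E]
    (σ : ℝ) (μ ν : Measure E) : ℝ≥0∞ :=
  ⨅ γ ∈ couplings μ ν,
    (∫⁻ p, ENNReal.ofReal (‖p.1 - p.2‖ ^ 2 / 2) ∂γ)
      + ENNReal.ofReal (σ ^ 2) * mutualInfo γ

/-- The density `φ_σ` of the centered Gaussian `N(0, σ² I_d)` on `ℝ^d`. -/
def gaussDensity (σ : ℝ) (d : ℕ) (z : EuclideanSpace ℝ (Fin d)) : ℝ :=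
  (2 * π * σ ^ 2) ^ (-(d : ℝ) / 2) * Real.exp (-‖z‖ ^ 2 / (2 * σ ^ 2))

/-- The empirical measure `(1/n) ∑ δ_{y i}`. -/
def empirical {α : Type*} [MeasurableSpace α] {n : ℕ} (y : Fin n → α) : Measure α :=
  (n : ℝ≥0∞)⁻¹ • ∑ i, Measure.dirac (y i)


/-- The functional `V(P)`: the infimum over probability measures `γ` on the product
with second marginal `U` of `(1/2)∫‖x − y‖² dγ + σ² I(γ) + σ² D(π_X γ ‖ P)`. -/
noncomputable def Vfun {E : Type*} [NormedAddCommGroup E] [MeasurableSpace E]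
    (σ : ℝ) (U P : Measure E) : ℝ≥0∞ :=
  ⨅ γ ∈ {γ : Measure (E × E) | IsProbabilityMeasure γ ∧ γ.map Prod.snd = U},
    (∫⁻ p, ENNReal.ofReal (‖p.1 - p.2‖ ^ 2 / 2) ∂γ)
      + ENNReal.ofReal (σ ^ 2) * mutualInfo γ
      + ENNReal.ofReal (σ ^ 2) * KLdiv (γ.map Prod.fst) P

lemma KLdiv_eq_klDiv {α : Type*} [MeasurableSpace α] (μ ν : Measure α)
    [IsProbabilityMeasure μ] [IsProbabilityMeasure ν] :
    KLdiv μ ν = InformationTheory.klDiv μ ν := by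
  rw [KLdiv, InformationTheory.klDiv_def]
  simp only [llr_def, probReal_univ, add_sub_cancel_right]
  congr

lemma KLdiv_self {α : Type*} [MeasurableSpace α] (μ : Measure α) [IsProbabilityMeasure μ] :
    KLdiv μ μ = 0 := by
  rw [KLdiv_eq_klDiv, InformationTheory.klDiv_self]

/-- Chain rule: `I(γ) + D(π_X γ ‖ P) = D(γ ‖ P ⊗ π_Y γ)`. -/
lemma mutualInfo_add_KLdiv_map_fst {α β : Type*} [MeasurableSpace α] [MeasurableSpace β]
    [StandardBorelSpace β] [Nonempty β] (γ : Measure (α × β)) [IsProbabilityMeasure γ]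
    (P : Measure α) [IsProbabilityMeasure P] :
    mutualInfo γ + KLdiv (γ.map Prod.fst) P
      = InformationTheory.klDiv γ (P.prod (γ.map Prod.snd)) := by
  have h1 : IsProbabilityMeasure (γ.map Prod.fst) :=
    Measure.isProbabilityMeasure_map measurable_fst.aemeasurable
  have h2 : IsProbabilityMeasure (γ.map Prod.snd) :=
    Measure.isProbabilityMeasure_map measurable_snd.aemeasurable
  have h := InformationTheory.klDiv_compProd_eq_add (μ := γ.map Prod.fst) (ν := P)
    (κ := γ.condKernel) (η := Kernel.const α (γ.map Prod.snd))
  have h3 : (γ.map Prod.fst).compProd γ.condKernel = γ := γ.disintegrate γ.condKernel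
  rw [h3, Measure.compProd_const, Measure.compProd_const] at h
  rw [mutualInfo, KLdiv_eq_klDiv, KLdiv_eq_klDiv, h, add_comm]

section Gibbs

variable {α β : Type*} [MeasurableSpace α] [MeasurableSpace β]

/-- The normalizing constant `∫ exp (-c(x, y) / s) dP(x)`. -/
def gibbsNorm (P : Measure α) (c : α × β → ℝ) (s : ℝ) (y : β) : ℝ :=
  ∫ x, exp (-c (x, y) / s) ∂P

/-- The logarithm of the normalized Gibbs density `exp (-c(x, y) / s) / gibbsNorm P c s y`. -/
def gibbsLogDensity (P : Measure α) (c : α × β → ℝ) (s : ℝ) (p : α × β) : ℝ :=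
  -c p / s - log (gibbsNorm P c s p.2)

variable {P : Measure α} {U : Measure β} {c : α × β → ℝ} {s : ℝ}

lemma integral_gibbsLogDensity {γ : Measure (α × β)} (hγ : γ.map Prod.snd = U)
    (hcγ : Integrable c γ) (hlog : Integrable (fun y ↦ log (gibbsNorm P c s y)) U) :
    Integrable (gibbsLogDensity P c s) γ ∧
      ∫ p, gibbsLogDensity P c s p ∂γ
        = -(∫ p, c p ∂γ) / s - ∫ y, log (gibbsNorm P c s y) ∂U := by
  subst hγ
  have hl := hlog.comp_measurable measurable_snd
  have h1 : Integrable (fun p ↦ -c p / s) γ := hcγ.neg.div_const s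
  refine ⟨h1.sub hl, ?_⟩
  rw [integral_map measurable_snd.aemeasurable hlog.aestronglyMeasurable, ← integral_neg,
    ← integral_div]
  exact integral_sub h1 hl

variable [IsProbabilityMeasure P] [IsProbabilityMeasure U]

lemma measurable_gibbsNorm (hc : Measurable c) : Measurable (gibbsNorm P c s) := by
  have h : StronglyMeasurable fun p : β × α ↦ exp (-c (p.2, p.1) / s) :=
    Measurable.stronglyMeasurable (by fun_prop)
  exact h.integral_prod_right.measurable

lemma measurable_gibbsLogDensity (hc : Measurable c) : Measurable (gibbsLogDensity P c s) := by
  have := measurable_gibbsNorm (P := P) (s := s) hc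
  unfold gibbsLogDensity
  fun_prop

lemma gibbsNorm_pos (hc : Measurable c) (hc0 : ∀ p, 0 ≤ c p) (hs : 0 < s) (y : β) :
    0 < gibbsNorm P c s y := by
  refine integral_exp_pos (Integrable.of_bound (C := 1)
    (Measurable.aestronglyMeasurable (by fun_prop)) (.of_forall fun x ↦ ?_))
  rw [norm_of_nonneg (exp_pos _).le, exp_le_one_iff, neg_div]
  exact neg_nonpos.2 (div_nonneg (hc0 _) hs.le)

lemma exp_gibbsLogDensity (hc : Measurable c) (hc0 : ∀ p, 0 ≤ c p) (hs : 0 < s) (p : α × β) :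
    exp (gibbsLogDensity P c s p) = exp (-c p / s) * (gibbsNorm P c s p.2)⁻¹ := by
  rw [gibbsLogDensity, exp_sub, exp_log (gibbsNorm_pos hc hc0 hs _), div_eq_mul_inv]

lemma integrable_exp_gibbsLogDensity (hc : Measurable c) (hc0 : ∀ p, 0 ≤ c p) (hs : 0 < s)
    (hinv : Integrable (fun y ↦ (gibbsNorm P c s y)⁻¹) U) :
    Integrable (fun p ↦ exp (gibbsLogDensity P c s p)) (P.prod U) := by
  have hm := measurable_gibbsLogDensity (P := P) (s := s) hc
  refine (hinv.comp_snd P).mono' (Measurable.aestronglyMeasurable (by fun_prop))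
    (.of_forall fun p ↦ ?_)
  rw [norm_of_nonneg (exp_pos _).le, exp_gibbsLogDensity hc hc0 hs]
  refine mul_le_of_le_one_left (inv_nonneg.2 (gibbsNorm_pos hc hc0 hs _).le) ?_
  rw [exp_le_one_iff, neg_div]
  exact neg_nonpos.2 (div_nonneg (hc0 _) hs.le)

lemma integral_exp_gibbsLogDensity_left (hc : Measurable c) (hc0 : ∀ p, 0 ≤ c p) (hs : 0 < s)
    (y : β) : ∫ x, exp (gibbsLogDensity P c s (x, y)) ∂P = 1 := by
  simp_rw [exp_gibbsLogDensity hc hc0 hs]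
  rw [integral_mul_const]
  exact mul_inv_cancel₀ (gibbsNorm_pos hc hc0 hs y).ne'

lemma integral_exp_gibbsLogDensity (hc : Measurable c) (hc0 : ∀ p, 0 ≤ c p) (hs : 0 < s)
    (hinv : Integrable (fun y ↦ (gibbsNorm P c s y)⁻¹) U) :
    ∫ p, exp (gibbsLogDensity P c s p) ∂(P.prod U) = 1 := by
  rw [integral_prod_symm _ (integrable_exp_gibbsLogDensity hc hc0 hs hinv)]
  simp [integral_exp_gibbsLogDensity_left hc hc0 hs]

lemma map_snd_tilted_gibbsLogDensity (hc : Measurable c) (hc0 : ∀ p, 0 ≤ c p) (hs : 0 < s)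
    (hinv : Integrable (fun y ↦ (gibbsNorm P c s y)⁻¹) U) :
    ((P.prod U).tilted (gibbsLogDensity P c s)).map Prod.snd = U := by
  ext B hB
  have hi := (integrable_exp_gibbsLogDensity hc hc0 hs hinv).integrableOn
    (s := Set.univ ×ˢ B)
  rw [Measure.map_apply measurable_snd hB,
    tilted_apply_eq_ofReal_integral' _ (measurable_snd hB),
    integral_exp_gibbsLogDensity hc hc0 hs hinv, ← Set.univ_prod]
  rw [IntegrableOn, ← Measure.prod_restrict] at hi
  simp only [div_one]
  rw [← Measure.prod_restrict, integral_prod_symm _ hi]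
  simp [integral_exp_gibbsLogDensity_left hc hc0 hs]

lemma integrable_cost_tilted_gibbsLogDensity (hc : Measurable c) (hc0 : ∀ p, 0 ≤ c p)
    (hs : 0 < s) (hinv : Integrable (fun y ↦ (gibbsNorm P c s y)⁻¹) U) :
    Integrable c ((P.prod U).tilted (gibbsLogDensity P c s)) := by
  have hm := measurable_gibbsLogDensity (P := P) (s := s) hc
  rw [integrable_tilted_iff (integrable_exp_gibbsLogDensity hc hc0 hs hinv)]
  refine ((hinv.comp_snd P).const_mul s).mono' (Measurable.aestronglyMeasurable (by fun_prop))
    (.of_forall fun p ↦ ?_)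
  rw [smul_eq_mul, norm_of_nonneg (mul_nonneg (exp_pos _).le (hc0 p)),
    exp_gibbsLogDensity hc hc0 hs]
  have hZ := inv_nonneg.2 (gibbsNorm_pos (P := P) hc hc0 hs p.2).le
  have h1 : exp (-c p / s) * c p ≤ s := by
    have h2 : c p / s ≤ exp (c p / s) := by linarith [add_one_le_exp (c p / s)]
    rw [neg_div, exp_neg, inv_mul_le_iff₀ (exp_pos _)]
    rw [div_le_iff₀ hs] at h2
    exact h2
  calc exp (-c p / s) * (gibbsNorm P c s p.2)⁻¹ * c p
      = (exp (-c p / s) * c p) * (gibbsNorm P c s p.2)⁻¹ := by ring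
    _ ≤ s * (gibbsNorm P c s p.2)⁻¹ := by gcongr

/-- Gibbs variational principle: the tilted measure with log-density `gibbsLogDensity` minimizes
`γ ↦ ∫ c dγ + s D(γ ‖ P ⊗ U)` among probability measures with second marginal `U`. -/
lemma tilted_gibbsLogDensity_le (hc : Measurable c) (hc0 : ∀ p, 0 ≤ c p) (hs : 0 < s)
    (hinv : Integrable (fun y ↦ (gibbsNorm P c s y)⁻¹) U)
    (hlog : Integrable (fun y ↦ log (gibbsNorm P c s y)) U)
    (γ : Measure (α × β)) [IsProbabilityMeasure γ] (hγ : γ.map Prod.snd = U) :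
    (∫⁻ p, ENNReal.ofReal (c p) ∂((P.prod U).tilted (gibbsLogDensity P c s)))
        + ENNReal.ofReal s * InformationTheory.klDiv
            ((P.prod U).tilted (gibbsLogDensity P c s)) (P.prod U)
      ≤ (∫⁻ p, ENNReal.ofReal (c p) ∂γ)
        + ENNReal.ofReal s * InformationTheory.klDiv γ (P.prod U) := by
  have hexp := integrable_exp_gibbsLogDensity hc hc0 hs hinv
  have hone := integral_exp_gibbsLogDensity hc hc0 hs hinv
  set f := gibbsLogDensity P c s with hf
  set R := P.prod U with hR
  have hG : IsProbabilityMeasure (R.tilted f) := isProbabilityMeasure_tilted hexp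
  by_cases hcγ : ∫⁻ p, ENNReal.ofReal (c p) ∂γ = ∞
  · simp [hcγ]
  by_cases hkl : InformationTheory.klDiv γ R = ∞
  · simp [hkl, ENNReal.mul_top, hs]
  obtain ⟨hac, hllr⟩ := InformationTheory.klDiv_ne_top_iff.1 hkl
  have hcost (μ : Measure (α × β)) (hμ : Integrable c μ) :
      ∫⁻ p, ENNReal.ofReal (c p) ∂μ = ENNReal.ofReal (∫ p, c p ∂μ) :=
    (ofReal_integral_eq_lintegral_ofReal hμ (.of_forall hc0)).symm
  have hciγ : Integrable c γ :=
    (lintegral_ofReal_ne_top_iff_integrable hc.aestronglyMeasurable (.of_forall hc0)).1 hcγ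
  have hciG : Integrable c (R.tilted f) :=
    integrable_cost_tilted_gibbsLogDensity hc hc0 hs hinv
  obtain ⟨hfγ, hfγ'⟩ := integral_gibbsLogDensity (P := P) (s := s) hγ hciγ hlog
  obtain ⟨hfG, hfG'⟩ := integral_gibbsLogDensity (P := P) (s := s)
    (map_snd_tilted_gibbsLogDensity (U := U) hc hc0 hs hinv) hciG hlog
  rw [← hf] at hfγ hfγ'
  rw [← hR, ← hf] at hfG hfG'
  have hllrG : llr (R.tilted f) R =ᵐ[R.tilted f] f := by
    filter_upwards [tilted_absolutelyContinuous R f (log_rnDeriv_tilted_left_self hexp)]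
      with p hp
    rw [llr, hp, hone, log_one, sub_zero]
  have hnonneg := InformationTheory.integral_llr_add_sub_measure_univ_nonneg
    (hac.trans (absolutelyContinuous_tilted hexp))
    (integrable_llr_tilted_right hac hfγ hllr hexp)
  rw [integral_llr_tilted_right hac hfγ hexp hllr, hone] at hnonneg
  simp only [log_one, add_zero, probReal_univ, add_sub_cancel_right] at hnonneg
  rw [hcost _ hciγ, hcost _ hciG, InformationTheory.klDiv_of_ac_of_integrable hac hllr,
    InformationTheory.klDiv_of_ac_of_integrable (tilted_absolutelyContinuous R f)
      ((integrable_congr hllrG).2 hfG), integral_congr_ae hllrG,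
    ← ENNReal.ofReal_mul hs.le, ← ENNReal.ofReal_mul hs.le]
  simp only [probReal_univ, add_sub_cancel_right]
  have e1 : s * ∫ p, f p ∂γ = -(∫ p, c p ∂γ) - s * ∫ y, log (gibbsNorm P c s y) ∂U := by
    rw [hfγ']; field_simp
  have e2 : s * ∫ p, f p ∂(R.tilted f)
      = -(∫ p, c p ∂(R.tilted f)) - s * ∫ y, log (gibbsNorm P c s y) ∂U := by
    rw [hfG']; field_simp
  have e3 : s * ∫ p, f p ∂γ ≤ s * ∫ p, llr γ R p ∂γ :=
    mul_le_mul_of_nonneg_left (sub_nonneg.1 hnonneg) hs.le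
  have hkG : 0 ≤ ∫ p, f p ∂(R.tilted f) := by
    have := InformationTheory.integral_llr_add_sub_measure_univ_nonneg
      (tilted_absolutelyContinuous R f) ((integrable_congr hllrG).2 hfG)
    simpa [integral_congr_ae hllrG] using this
  have hkγ : 0 ≤ ∫ p, llr γ R p ∂γ := by
    simpa using InformationTheory.integral_llr_add_sub_measure_univ_nonneg hac hllr
  rw [← ENNReal.ofReal_add (integral_nonneg hc0) (mul_nonneg hs.le hkG),
    ← ENNReal.ofReal_add (integral_nonneg hc0) (mul_nonneg hs.le hkγ)]
  exact ENNReal.ofReal_le_ofReal (by linarith)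

end Gibbs

lemma isProbabilityMeasure_empirical {α : Type*} [MeasurableSpace α] {n : ℕ} (hn : 0 < n)
    (y : Fin n → α) : IsProbabilityMeasure (empirical y) := by
  constructor
  simp [empirical, ENNReal.inv_mul_cancel (Nat.cast_ne_zero.2 hn.ne')]

lemma integrable_empirical {α : Type*} [MeasurableSpace α] {n : ℕ} (hn : 0 < n)
    (y : Fin n → α) {g : α → ℝ} (hg : Measurable g) : Integrable g (empirical y) := by
  refine Integrable.smul_measure ?_ (by simp [hn.ne'])
  rw [integrable_finsetSum_measure]
  intro i _
  exact integrable_dirac' hg.stronglyMeasurable (by simp)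

section Wasserstein

variable {E : Type*} [NormedAddCommGroup E] [MeasurableSpace E]

lemma Vfun_le_entropicOT (σ : ℝ) (U P : Measure E) [IsProbabilityMeasure P] :
    Vfun σ U P ≤ entropicOT σ P U := by
  refine le_iInf₂ fun γ hγ ↦ ?_
  obtain ⟨hγ, hfst, hsnd⟩ := hγ
  refine (iInf₂_le γ ⟨hγ, hsnd⟩).trans ?_
  simp [hfst, KLdiv_self]

lemma iInf_entropicOT_le_Vfun {σ : ℝ} (hσ : 0 < σ) {U P : Measure E}
    {Pclass : Set (Measure E)} (hP : P ∈ Pclass)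
    (hdom : ∀ P ∈ Pclass, ∀ Q : Measure E, IsProbabilityMeasure Q → Q ≪ P → Q ∈ Pclass) :
    ⨅ P ∈ Pclass, entropicOT σ P U ≤ Vfun σ U P := by
  refine le_iInf₂ fun γ hγ ↦ ?_
  obtain ⟨hγ, hsnd⟩ := hγ
  by_cases hkl : KLdiv (γ.map Prod.fst) P = ∞
  · simp [hkl, ENNReal.mul_top, hσ.ne']
  have hac : γ.map Prod.fst ≪ P := by
    by_contra h
    exact hkl (by simp [KLdiv, h])
  have hQ := hdom P hP _ (Measure.isProbabilityMeasure_map measurable_fst.aemeasurable) hac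
  exact (iInf₂_le _ hQ).trans ((iInf₂_le γ ⟨hγ, rfl, hsnd⟩).trans le_self_add)

/-- The infimum defining `Vfun σ (empirical y) P` is attained. -/
lemma exists_Vfun_empirical_eq [BorelSpace E] [SecondCountableTopology E] [StandardBorelSpace E]
    {n : ℕ} (hn : 0 < n) {σ : ℝ} (hσ : 0 < σ) (y : Fin n → E) (P : Measure E)
    [IsProbabilityMeasure P] :
    ∃ γ : Measure (E × E), IsProbabilityMeasure γ ∧ γ.map Prod.snd = empirical y ∧
      (∫⁻ p, ENNReal.ofReal (‖p.1 - p.2‖ ^ 2 / 2) ∂γ) + ENNReal.ofReal (σ ^ 2) * mutualInfo γ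
        + ENNReal.ofReal (σ ^ 2) * KLdiv (γ.map Prod.fst) P = Vfun σ (empirical y) P := by
  have hU := isProbabilityMeasure_empirical hn y
  let c : E × E → ℝ := fun p ↦ ‖p.1 - p.2‖ ^ 2 / 2
  have hc : Measurable c := by fun_prop
  have hc0 : ∀ p, 0 ≤ c p := fun p ↦ by positivity
  have hs : 0 < σ ^ 2 := by positivity
  have hZ := measurable_gibbsNorm (P := P) (s := σ ^ 2) hc
  have hinv := integrable_empirical hn y hZ.inv
  have hlog := integrable_empirical hn y hZ.log
  have hG : IsProbabilityMeasure
      ((P.prod (empirical y)).tilted (gibbsLogDensity P c (σ ^ 2))) :=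
    isProbabilityMeasure_tilted (integrable_exp_gibbsLogDensity hc hc0 hs hinv)
  have hGsnd := map_snd_tilted_gibbsLogDensity hc hc0 hs hinv
  refine ⟨_, hG, hGsnd, le_antisymm (le_iInf₂ fun γ hγ ↦ ?_) (iInf₂_le _ ⟨hG, hGsnd⟩)⟩
  obtain ⟨hγ, hsnd⟩ := hγ
  rw [add_assoc, ← mul_add, mutualInfo_add_KLdiv_map_fst, hGsnd, add_assoc, ← mul_add,
    mutualInfo_add_KLdiv_map_fst, hsnd]
  exact tilted_gibbsLogDensity_le hc hc0 hs hinv hlog γ hsnd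

/-- If `Vfun σ (empirical y) P` is bounded by the infimum of the entropic transport costs over the
class, then so is the entropic transport cost of `P`. -/
lemma entropicOT_le_of_Vfun_le [BorelSpace E] [SecondCountableTopology E] [StandardBorelSpace E]
    {n : ℕ} (hn : 0 < n) {σ : ℝ} (hσ : 0 < σ) (y : Fin n → E) {P : Measure E}
    [IsProbabilityMeasure P] {Pclass : Set (Measure E)} (hP : P ∈ Pclass)
    (hdom : ∀ P ∈ Pclass, ∀ Q : Measure E, IsProbabilityMeasure Q → Q ≪ P → Q ∈ Pclass)
    (hV : Vfun σ (empirical y) P ≤ ⨅ Q ∈ Pclass, entropicOT σ Q (empirical y)) :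
    entropicOT σ P (empirical y) ≤ ⨅ Q ∈ Pclass, entropicOT σ Q (empirical y) := by
  by_cases htop : ⨅ Q ∈ Pclass, entropicOT σ Q (empirical y) = ∞
  · simp [htop]
  obtain ⟨γ, hγ, hsnd, hγV⟩ := exists_Vfun_empirical_eq hn hσ y P
  have hs : ENNReal.ofReal (σ ^ 2) ≠ 0 := by simp [hσ.ne']
  have hQ : IsProbabilityMeasure (γ.map Prod.fst) :=
    Measure.isProbabilityMeasure_map measurable_fst.aemeasurable
  rw [← hγV] at hV
  have hac : γ.map Prod.fst ≪ P := by
    by_contra h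
    have hkl : KLdiv (γ.map Prod.fst) P = ∞ := by simp [KLdiv, h]
    rw [hkl, ENNReal.mul_top hs, add_top, top_le_iff] at hV
    exact htop hV
  have hle : ⨅ Q ∈ Pclass, entropicOT σ Q (empirical y)
      ≤ (∫⁻ p, ENNReal.ofReal (‖p.1 - p.2‖ ^ 2 / 2) ∂γ)
        + ENNReal.ofReal (σ ^ 2) * mutualInfo γ :=
    (iInf₂_le _ (hdom P hP _ hQ hac)).trans (iInf₂_le γ ⟨hγ, rfl, hsnd⟩)
  have hfin := ne_top_of_le_ne_top htop (le_self_add.trans hV)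
  have hzero : ENNReal.ofReal (σ ^ 2) * KLdiv (γ.map Prod.fst) P = 0 := by
    have h := hV.trans hle
    nth_rw 2 [← add_zero (_ + ENNReal.ofReal (σ ^ 2) * mutualInfo γ)] at h
    exact le_antisymm (ENNReal.le_of_add_le_add_left hfin h) zero_le
  have hPQ : γ.map Prod.fst = P := by
    rw [KLdiv_eq_klDiv] at hzero
    exact InformationTheory.klDiv_eq_zero_iff.1 ((mul_eq_zero.1 hzero).resolve_left hs)
  rw [hzero, add_zero] at hV
  exact (iInf₂_le γ ⟨hγ, hPQ, hsnd⟩).trans hV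

end Wasserstein

/-- For a class `Pclass` of probability measures with finite second moments that is
closed under domination, `inf_{P ∈ Pclass} V(P) = inf_{P ∈ Pclass} W_{σ²}(P, U)`, and
`P̂ ∈ Pclass` minimizes `V` over `Pclass` iff it minimizes `P ↦ W_{σ²}(P, U)`. -/
theorem iInf_Vfun_eq_iInf_entropicOT {d n : ℕ} (hn : 0 < n) (σ : ℝ) (hσ : 0 < σ)
    (y : Fin n → EuclideanSpace ℝ (Fin d))
    (Pclass : Set (Measure (EuclideanSpace ℝ (Fin d))))
    (hprob : ∀ P ∈ Pclass, IsProbabilityMeasure P)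
    (hmom : ∀ P ∈ Pclass, Integrable (fun x => ‖x‖ ^ 2) P)
    (hdom : ∀ P ∈ Pclass, ∀ Q : Measure (EuclideanSpace ℝ (Fin d)),
      IsProbabilityMeasure Q → Q ≪ P → Q ∈ Pclass) :
    (⨅ P ∈ Pclass, Vfun σ (empirical y) P)
        = (⨅ P ∈ Pclass, entropicOT σ P (empirical y)) ∧
    ∀ Phat ∈ Pclass,
      ((∀ P ∈ Pclass, Vfun σ (empirical y) Phat ≤ Vfun σ (empirical y) P) ↔
        (∀ P ∈ Pclass, entropicOT σ Phat (empirical y) ≤ entropicOT σ P (empirical y))) := by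
  have hVW : (⨅ P ∈ Pclass, Vfun σ (empirical y) P)
      = ⨅ P ∈ Pclass, entropicOT σ P (empirical y) := by
    refine le_antisymm (iInf₂_mono fun P hP ↦ ?_)
      (le_iInf₂ fun P hP ↦ iInf_entropicOT_le_Vfun hσ hP hdom)
    have := hprob P hP
    exact Vfun_le_entropicOT σ _ P
  refine ⟨hVW, fun Phat hPhat ↦ ?_⟩
  have := hprob Phat hPhat
  constructor <;> intro h
  · refine le_iInf₂_iff.1 (entropicOT_le_of_Vfun_le hn hσ y hPhat hdom ?_)
    rw [← hVW]
    exact le_iInf₂ h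
  · refine le_iInf₂_iff.1 ?_
    rw [hVW]
    exact (Vfun_le_entropicOT σ _ Phat).trans (le_iInf₂ h)

end
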